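/- arXiv:1808.02871 — 7 statements merged into one kernel-verified Lean document; each statement's English description precedes it below -/
import Mathlib

section
/- Let N ≥ 1 and let d_0, …, d_{3^N−1} ∈ ℝ^N be the rows of the semi-lexicographic perturbation matrix D_N. Then ∑_{m=0}^{3^N−1} d_m d_mᵀ = 2·3^N · I_N, i.e., D_Nᵀ D_N = 2·3^N I_N; in particular the columns of D_N are mutually orthogonal and each has squared Euclidean norm 2·3^N. -/
open Matrix

/-- The semi-lexicographic perturbation matrix `D_N`, given entrywise:
`Dlex N m i` is the entry of `D_N` in row `m ∈ {0,…,3^N−1}` and column `i ∈ {0,…,N−1}`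
(0-indexed).  `D_1` is the column `(−1,−1,2)ᵀ`; the first column of `D_{k+1}` consists of
`2·3^k` entries equal to `−1` followed by `3^k` entries equal to `2`, and for `i ≥ 1` the
`i`-th column of `D_{k+1}` is the `(i−1)`-th column of `D_k` stacked vertically three times. -/
def Dlex : ℕ → ℕ → ℕ → ℝ
  | 0, _, _ => 0
  | (N + 1), m, 0 => if m < 2 * 3 ^ N then -1 else 2
  | (N + 1), m, (i + 1) => Dlex N (m % 3 ^ N) i

theorem sum_range_three_mul {M : Type*} [AddCommMonoid M] (n : ℕ) (f : ℕ → M) :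
    ∑ m ∈ Finset.range (3 * n), f m =
      ∑ m ∈ Finset.range n, (f m + f (n + m) + f (2 * n + m)) := by
  rw [show 3 * n = n + n + n by ring, Finset.sum_range_add, Finset.sum_range_add,
    Finset.sum_add_distrib, Finset.sum_add_distrib, two_mul]

theorem Dlex_first_block_zero {N m : ℕ} (hm : m < 3 ^ N) : Dlex (N + 1) m 0 = -1 := by
  rw [Dlex, if_pos (by omega)]

theorem Dlex_second_block_zero {N m : ℕ} (hm : m < 3 ^ N) :
    Dlex (N + 1) (3 ^ N + m) 0 = -1 := by
  rw [Dlex, if_pos (by omega)]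

theorem Dlex_third_block_zero (N m : ℕ) : Dlex (N + 1) (2 * 3 ^ N + m) 0 = 2 := by
  rw [Dlex, if_neg (by omega)]

theorem Dlex_first_block_succ {N m : ℕ} (hm : m < 3 ^ N) (i : ℕ) :
    Dlex (N + 1) m (i + 1) = Dlex N m i := by
  rw [Dlex, Nat.mod_eq_of_lt hm]

theorem Dlex_second_block_succ {N m : ℕ} (hm : m < 3 ^ N) (i : ℕ) :
    Dlex (N + 1) (3 ^ N + m) (i + 1) = Dlex N m i := by
  rw [Dlex, Nat.add_mod_left, Nat.mod_eq_of_lt hm]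

theorem Dlex_third_block_succ {N m : ℕ} (hm : m < 3 ^ N) (i : ℕ) :
    Dlex (N + 1) (2 * 3 ^ N + m) (i + 1) = Dlex N m i := by
  rw [Dlex, Nat.mul_add_mod_self_right, Nat.mod_eq_of_lt hm]

/-- The inner products of the columns of `D_N`. -/
theorem sum_Dlex_mul_Dlex (N i j : ℕ) (hi : i < N) (hj : j < N) :
    ∑ m ∈ Finset.range (3 ^ N), Dlex N m i * Dlex N m j = if i = j then 2 * 3 ^ N else 0 := by
  induction N generalizing i j with
  | zero => omega
  | succ N ih =>
    have zero_succ (k : ℕ) :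
        ∑ m ∈ Finset.range (3 ^ (N + 1)), Dlex (N + 1) m 0 * Dlex (N + 1) m (k + 1) = 0 := by
      rw [pow_succ', sum_range_three_mul]
      refine Finset.sum_eq_zero fun m hm => ?_
      rw [Finset.mem_range] at hm
      rw [Dlex_first_block_zero hm, Dlex_second_block_zero hm, Dlex_third_block_zero,
        Dlex_first_block_succ hm, Dlex_second_block_succ hm, Dlex_third_block_succ hm]
      ring
    rcases i with _ | i <;> rcases j with _ | j
    · rw [pow_succ', sum_range_three_mul]
      calc _ = ∑ m ∈ Finset.range (3 ^ N), (6 : ℝ) := by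
            refine Finset.sum_congr rfl fun m hm => ?_
            rw [Finset.mem_range] at hm
            rw [Dlex_first_block_zero hm, Dlex_second_block_zero hm, Dlex_third_block_zero]
            norm_num
        _ = _ := by
            simp
            ring
    · simpa using zero_succ j
    · simpa [mul_comm] using zero_succ i
    · rw [pow_succ' 3 N, sum_range_three_mul]
      calc _ = ∑ m ∈ Finset.range (3 ^ N), 3 * (Dlex N m i * Dlex N m j) := by
            refine Finset.sum_congr rfl fun m hm => ?_
            rw [Finset.mem_range] at hm
            simp only [Dlex_first_block_succ hm, Dlex_second_block_succ hm,
              Dlex_third_block_succ hm]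
            ring
        _ = _ := by
            rw [← Finset.mul_sum, ih i j (by omega) (by omega)]
            simp only [Nat.add_right_cancel_iff]
            split_ifs <;> ring

/-- For `N ≥ 1`, the rows `d_0,…,d_{3^N−1}` of the semi-lexicographic
perturbation matrix `D_N` satisfy `∑_m d_m d_mᵀ = D_Nᵀ D_N = 2·3^N · I_N`; in particular the
columns of `D_N` are mutually orthogonal, each with squared Euclidean norm `2·3^N`. -/
theorem lex_matrix_transpose_mul_self (N : ℕ) (hN : 1 ≤ N) :
    (Matrix.of fun (m : Fin (3 ^ N)) (i : Fin N) => Dlex N m i)ᵀ *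
      (Matrix.of fun (m : Fin (3 ^ N)) (i : Fin N) => Dlex N m i) =
      ((2 * 3 ^ N : ℕ) : ℝ) • (1 : Matrix (Fin N) (Fin N) ℝ) := by
  ext i j
  simp only [Matrix.mul_apply, Matrix.transpose_apply, Matrix.of_apply, Matrix.smul_apply,
    Matrix.one_apply, smul_eq_mul, mul_ite, mul_one, mul_zero]
  rw [Fin.sum_univ_eq_sum_range (fun m => Dlex N m i * Dlex N m j),
    sum_Dlex_mul_Dlex N i j i.isLt j.isLt]
  simp [Fin.ext_iff]
end

section
/- Let N ≥ 2 and let d_0, …, d_{3^N−1} ∈ ℝ^N be the rows of the semi-lexicographic perturbation matrix D_N. Then for every pair of distinct coordinate indices i ≠ j in {1,…,N}, ∑_{m=0}^{3^N−1} (d_m^i)^2 (d_m^j)^2 = 4·3^N. -/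
open Matrix Finset

/-- A sum over `range (3 ^ (N + 1))` splits into three consecutive blocks of length `3 ^ N`. -/
theorem sum_range_three_pow_succ (N : ℕ) (f : ℕ → ℝ) :
    ∑ m ∈ Finset.range (3 ^ (N + 1)), f m =
      ∑ m ∈ Finset.range (3 ^ N), (f m + f (3 ^ N + m) + f (3 ^ N + 3 ^ N + m)) := by
  rw [show 3 ^ (N + 1) = 3 ^ N + 3 ^ N + 3 ^ N by ring, Finset.sum_range_add,
    Finset.sum_range_add, Finset.sum_add_distrib, Finset.sum_add_distrib]

/-- Summing a function of the first entry and of the remaining entries over the rows of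
`D_{N+1}`: the first entry takes the values `-1, -1, 2` on three copies of `D_N`. -/
theorem sum_Dlex_succ (N : ℕ) (F : ℝ → (ℕ → ℝ) → ℝ) :
    ∑ m ∈ Finset.range (3 ^ (N + 1)),
        F (Dlex (N + 1) m 0) (fun i => Dlex (N + 1) m (i + 1)) =
      ∑ m ∈ Finset.range (3 ^ N),
        (F (-1) (Dlex N m) + F (-1) (Dlex N m) + F 2 (Dlex N m)) := by
  rw [sum_range_three_pow_succ]
  refine Finset.sum_congr rfl fun m hm => ?_
  have hm' : m < 3 ^ N := Finset.mem_range.mp hm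
  have h0 : m < 2 * 3 ^ N := by omega
  have h1 : 3 ^ N + m < 2 * 3 ^ N := by omega
  have h2 : ¬ 3 ^ N + 3 ^ N + m < 2 * 3 ^ N := by omega
  have e2 : (3 ^ N + 3 ^ N + m) % 3 ^ N = m := by
    rw [add_assoc, Nat.add_mod_left, Nat.add_mod_left, Nat.mod_eq_of_lt hm']
  simp only [Dlex, if_pos h0, if_pos h1, if_neg h2, e2, Nat.add_mod_left,
    Nat.mod_eq_of_lt hm']

theorem sum_Dlex_sq (N i : ℕ) (hi : i < N) :
    ∑ m ∈ Finset.range (3 ^ N), Dlex N m i ^ 2 = 2 * 3 ^ N := by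
  induction N generalizing i with
  | zero => omega
  | succ N ih =>
    cases i with
    | zero =>
      rw [sum_Dlex_succ N fun a _ => a ^ 2, Finset.sum_const, Finset.card_range, nsmul_eq_mul]
      push_cast
      ring
    | succ i =>
      rw [sum_Dlex_succ N fun _ v => v i ^ 2, Finset.sum_add_distrib, Finset.sum_add_distrib,
        ih i (by omega)]
      ring

theorem sum_Dlex_zero_sq_mul_sq (N i : ℕ) (hi : i < N) :
    ∑ m ∈ Finset.range (3 ^ (N + 1)), Dlex (N + 1) m 0 ^ 2 * Dlex (N + 1) m (i + 1) ^ 2 =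
      4 * 3 ^ (N + 1) := by
  rw [sum_Dlex_succ N fun a v => a ^ 2 * v i ^ 2, Finset.sum_add_distrib,
    Finset.sum_add_distrib, ← Finset.mul_sum, ← Finset.mul_sum, sum_Dlex_sq N i hi]
  ring

theorem sum_Dlex_sq_mul_sq (N i j : ℕ) (hi : i < N) (hj : j < N) (hij : i ≠ j) :
    ∑ m ∈ Finset.range (3 ^ N), Dlex N m i ^ 2 * Dlex N m j ^ 2 = 4 * 3 ^ N := by
  induction N generalizing i j with
  | zero => omega
  | succ N ih =>
    rcases i with _ | i <;> rcases j with _ | j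
    · exact absurd rfl hij
    · exact sum_Dlex_zero_sq_mul_sq N j (by omega)
    · simp only [mul_comm (Dlex (N + 1) _ (i + 1) ^ 2)]
      exact sum_Dlex_zero_sq_mul_sq N i (by omega)
    · rw [sum_Dlex_succ N fun _ v => v i ^ 2 * v j ^ 2, Finset.sum_add_distrib,
        Finset.sum_add_distrib, ih i j (by omega) (by omega) (by omega)]
      ring

/-- For `N ≥ 2` and distinct coordinate indices `i ≠ j`, the rows `d_m` of the
semi-lexicographic perturbation matrix `D_N` satisfy `∑ m, (Dlex N m i)^2 * (Dlex N m j)^2 = 4*3^N`. -/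
theorem lex_matrix_square_cross_sum (N : ℕ) (hN : 2 ≤ N) (i j : ℕ) (hi : i < N) (hj : j < N)
    (hij : i ≠ j) :
    (∑ m ∈ Finset.range (3 ^ N), (Dlex N m i) ^ 2 * (Dlex N m j) ^ 2)
      = ((4 * 3 ^ N : ℕ) : ℝ) := by
  rw [sum_Dlex_sq_mul_sq N i j hi hj hij]
  push_cast
  rfl
end

section
/- Let N ≥ 2 and let d_0, …, d_{3^N−1} ∈ ℝ^N be the rows of the semi-lexicographic perturbation matrix D_N. Then for all coordinate indices k ≠ l in {1,…,N} and every coordinate index i ∈ {1,…,N} (including i = k or i = l), ∑_{m=0}^{3^N−1} d_m^k · d_m^l · (d_m^i)^2 = 0. -/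
open Matrix Finset

/-- A sum over the rows of `D_{N+1}` splits into the three stacked blocks of rows of `D_N`. -/
lemma sum_rows_Dlex_succ (N : ℕ) (F : (ℕ → ℝ) → ℝ) :
    ∑ m ∈ range (3 ^ (N + 1)), F (Dlex (N + 1) m) =
      ∑ m ∈ range (3 ^ N),
        (2 * F (fun j => Nat.casesOn j (-1) (Dlex N m)) +
          F (fun j => Nat.casesOn j 2 (Dlex N m))) := by
  have hsplit : 3 ^ (N + 1) = 3 ^ N + 3 ^ N + 3 ^ N := by ring
  rw [hsplit, sum_range_add, sum_range_add, ← sum_add_distrib, ← sum_add_distrib]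
  refine sum_congr rfl fun m hm => ?_
  have hm' : m < 3 ^ N := mem_range.1 hm
  have h0 : Dlex (N + 1) m = fun j => Nat.casesOn j (-1) (Dlex N m) := by
    funext j
    cases j with
    | zero => exact if_pos (by omega)
    | succ j => simp [Dlex, Nat.mod_eq_of_lt hm']
  have h1 : Dlex (N + 1) (3 ^ N + m) = fun j => Nat.casesOn j (-1) (Dlex N m) := by
    funext j
    cases j with
    | zero => exact if_pos (by omega)
    | succ j => simp [Dlex, Nat.mod_eq_of_lt hm']
  have h2 : Dlex (N + 1) (3 ^ N + 3 ^ N + m) = fun j => Nat.casesOn j 2 (Dlex N m) := by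
    funext j
    cases j with
    | zero => exact if_neg (by omega)
    | succ j => simp [Dlex, Nat.mod_eq_of_lt hm', add_assoc]
  rw [h0, h1, h2]
  ring

/-- Each column of `D_N` is orthogonal to every function of the other columns. -/
lemma sum_Dlex_mul_eq_zero {N k : ℕ} (hk : k < N) (g : (ℕ → ℝ) → ℝ)
    (hg : ∀ v w : ℕ → ℝ, (∀ j, j ≠ k → v j = w j) → g v = g w) :
    ∑ m ∈ range (3 ^ N), Dlex N m k * g (Dlex N m) = 0 := by
  induction N generalizing k g with
  | zero => omega
  | succ N ih =>
    rw [sum_rows_Dlex_succ N fun v => v k * g v]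
    cases k with
    | zero =>
      refine sum_eq_zero fun m _ => ?_
      rw [hg (fun j => Nat.casesOn j (-1) (Dlex N m)) (fun j => Nat.casesOn j 2 (Dlex N m))
        fun j hj => by cases j <;> simp_all]
      change 2 * (-1 * g _) + 2 * g _ = (0 : ℝ)
      ring
    | succ k =>
      have block (c : ℝ) : ∑ m ∈ range (3 ^ N),
          Dlex N m k * g (fun j => Nat.casesOn j c (Dlex N m)) = 0 := by
        refine ih (Nat.lt_of_succ_lt_succ hk) (fun v => g fun j => Nat.casesOn j c v) fun v w h => hg _ _ ?_
        intro j hj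
        cases j with
        | zero => rfl
        | succ j => exact h j (by omega)
      rw [sum_add_distrib, ← mul_sum]
      simp only [block, mul_zero, add_zero]

/-- For `N ≥ 2`, distinct coordinate indices `k ≠ l`, and every coordinate
index `i` (including `i = k` or `i = l`), the rows of the semi-lexicographic perturbation
matrix `D_N` satisfy `∑ m, Dlex N m k * Dlex N m l * (Dlex N m i)^2 = 0`. -/
theorem lex_matrix_cross_square_sum_zero (N : ℕ) (hN : 2 ≤ N) (k l i : ℕ)
    (hk : k < N) (hl : l < N) (hi : i < N) (hkl : k ≠ l) :
    (∑ m ∈ Finset.range (3 ^ N), Dlex N m k * Dlex N m l * (Dlex N m i) ^ 2) = 0 := by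
  by_cases hik : i = k
  · subst hik
    rw [← sum_Dlex_mul_eq_zero hl (fun v => v i * v i ^ 2) fun v w h => by simp [h i hkl]]
    exact sum_congr rfl fun m _ => by ring
  · rw [← sum_Dlex_mul_eq_zero hk (fun v => v l * v i ^ 2)
      fun v w h => by simp [h l hkl.symm, h i hik]]
    exact sum_congr rfl fun m _ => by ring
end

section
/- Let N ≥ 4 and let d_0, …, d_{3^N−1} ∈ ℝ^N be the rows of the semi-lexicographic perturbation matrix D_N. Then for all pairwise distinct coordinate indices i, j, k, l in {1,…,N}, ∑_{m=0}^{3^N−1} d_m^i · d_m^j · d_m^k · d_m^l = 0. -/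
open Matrix Finset

/-- Sums over the rows of `D_N` of products of functions of the single entries factor over the
columns, each column contributing its values `-1, -1, 2` independently. -/
theorem sum_prod_Dlex (N : ℕ) (f : ℕ → ℝ → ℝ) :
    ∑ m ∈ range (3 ^ N), ∏ i ∈ range N, f i (Dlex N m i) =
      ∏ i ∈ range N, (f i (-1) + f i (-1) + f i 2) := by
  induction N generalizing f with
  | zero => simp
  | succ N ih =>
    have hpow : 3 ^ (N + 1) = 3 ^ N + 3 ^ N + 3 ^ N := by ring
    have hblock (x : ℝ) (g : ℕ → ℕ)
        (hg : ∀ m < 3 ^ N, g m % 3 ^ N = m)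
        (hx : ∀ m < 3 ^ N, (if g m < 2 * 3 ^ N then (-1 : ℝ) else 2) = x) :
        ∑ m ∈ range (3 ^ N), ∏ i ∈ range (N + 1), f i (Dlex (N + 1) (g m) i) =
          (∏ i ∈ range N, (f (i + 1) (-1) + f (i + 1) (-1) + f (i + 1) 2)) * f 0 x := by
      rw [← ih fun i => f (i + 1), sum_mul]
      refine sum_congr rfl fun m hm => ?_
      rw [mem_range] at hm
      simp only [prod_range_succ', Dlex, hg m hm, hx m hm]
    rw [hpow, sum_range_add, sum_range_add,
      hblock (-1) (fun m => m) (fun m hm => Nat.mod_eq_of_lt hm)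
        (fun m hm => if_pos (by omega)),
      hblock (-1) (fun m => 3 ^ N + m)
        (fun m hm => by rw [Nat.add_mod_left, Nat.mod_eq_of_lt hm])
        (fun m hm => if_pos (by omega)),
      hblock 2 (fun m => 3 ^ N + 3 ^ N + m)
        (fun m hm => by rw [add_assoc, Nat.add_mod_left, Nat.add_mod_left, Nat.mod_eq_of_lt hm])
        (fun m hm => if_neg (by omega)),
      prod_range_succ']
    ring

/-- The product of any nonempty set of columns of `D_N` sums to zero over the rows. -/
theorem sum_prod_Dlex_eq_zero {N : ℕ} {S : Finset ℕ} (hS : S.Nonempty) (hSN : S ⊆ range N) :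
    ∑ m ∈ range (3 ^ N), ∏ i ∈ S, Dlex N m i = 0 := by
  obtain ⟨i, hi⟩ := hS
  have h := sum_prod_Dlex N fun i x => if i ∈ S then x else 1
  simp only [prod_ite_mem, inter_eq_right.mpr hSN] at h
  rw [h]
  exact prod_eq_zero (hSN hi) (by norm_num [hi])

/-- For `N ≥ 4` and pairwise distinct coordinate indices `i, j, k, l`, the rows
of the semi-lexicographic perturbation matrix `D_N` satisfy
`∑ m, Dlex N m i * Dlex N m j * Dlex N m k * Dlex N m l = 0`. -/
theorem lex_matrix_quadruple_product_sum_zero (N : ℕ) (hN : 4 ≤ N) (i j k l : ℕ)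
    (hi : i < N) (hj : j < N) (hk : k < N) (hl : l < N)
    (hij : i ≠ j) (hik : i ≠ k) (hil : i ≠ l) (hjk : j ≠ k) (hjl : j ≠ l) (hkl : k ≠ l) :
    (∑ m ∈ Finset.range (3 ^ N), Dlex N m i * Dlex N m j * Dlex N m k * Dlex N m l) = 0 := by
  have h := sum_prod_Dlex_eq_zero (N := N) (S := {i, j, k, l}) (insert_nonempty _ _)
    (by simp [insert_subset_iff, hi, hj, hk, hl])
  rw [← h]
  refine sum_congr rfl fun m _ => ?_
  rw [prod_insert (by simp [hij, hik, hil]), prod_insert (by simp [hjk, hjl]),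
    prod_insert (by simp [hkl]), prod_singleton]
  ring
end

section
/- Let f : ℝ^N → ℝ be four times continuously differentiable and suppose all fourth-order partial derivatives of f are bounded in absolute value by α₀ > 0 on all of ℝ^N. Then for every x ∈ ℝ^N, every d ∈ ℝ^N, and every δ > 0, the second difference satisfies | (f(x + δd) + f(x − δd) − 2 f(x)) / δ² − dᵀ∇²f(x) d | ≤ (α₀ δ² / 12) · (∑_{i=1}^N |d_i|)⁴, where ∇²f(x) denotes the Hessian matrix of f at x. -/
open Finset

/-- A multilinear form on `ℝ^N` bounded by `C` on tuples of standard basis vectors is bounded by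
`C` times the `n`-th power of the `ℓ¹` norm on the diagonal. -/
theorem ContinuousMultilinearMap.abs_apply_diag_le_of_single {ι : Type*} [Fintype ι]
    [DecidableEq ι] {n : ℕ} (T : ContinuousMultilinearMap ℝ (fun _ : Fin n => ι → ℝ) ℝ) {C : ℝ}
    (hT : ∀ r : Fin n → ι, |T fun k => Pi.single (r k) 1| ≤ C) (d : ι → ℝ) :
    |T fun _ => d| ≤ C * (∑ i, |d i|) ^ n := by
  have hd : d = ∑ i, d i • (Pi.single i 1 : ι → ℝ) := pi_eq_sum_univ' d
  have hexp : (T fun _ => d) =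
      ∑ r : Fin n → ι, (∏ k, d (r k)) * T fun k => Pi.single (r k) 1 := by
    conv_lhs => rw [hd]
    rw [T.map_sum (g := fun (_ : Fin n) i => d i • (Pi.single i 1 : ι → ℝ))]
    exact sum_congr rfl fun r _ => T.map_smul_univ (fun k => d (r k)) _
  calc |T fun _ => d|
      ≤ ∑ r : Fin n → ι, |(∏ k, d (r k)) * T fun k => Pi.single (r k) 1| := by
        rw [hexp]; exact abs_sum_le_sum_abs _ _
    _ ≤ ∑ r : Fin n → ι, C * ∏ k, |d (r k)| := by
        refine sum_le_sum fun r _ => ?_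
        rw [abs_mul, abs_prod, mul_comm]
        exact mul_le_mul_of_nonneg_right (hT r) (prod_nonneg fun _ _ => abs_nonneg _)
    _ = C * (∑ i, |d i|) ^ n := by
        rw [← mul_sum, Fintype.sum_pow]

theorem iteratedDeriv_comp_add_smul {E F : Type*} [NormedAddCommGroup E] [NormedSpace ℝ E]
    [NormedAddCommGroup F] [NormedSpace ℝ F] {f : E → F} {n : WithTop ℕ∞} (hf : ContDiff ℝ n f)
    (x d : E) {k : ℕ} (hk : k ≤ n) (t : ℝ) :
    iteratedDeriv k (fun s : ℝ => f (x + s • d)) t =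
      iteratedFDeriv ℝ k f (x + t • d) fun _ => d := by
  have hx : ContDiff ℝ n fun z => f (x + z) := by fun_prop
  have h := (ContinuousLinearMap.toSpanSingleton ℝ d).iteratedFDeriv_comp_right hx t hk
  rw [iteratedFDeriv_comp_add_left] at h
  rw [iteratedDeriv_eq_iteratedFDeriv]
  change iteratedFDeriv ℝ k ((fun z => f (x + z)) ∘ ContinuousLinearMap.toSpanSingleton ℝ d) t _ = _
  rw [h]
  simp

theorem abs_sub_taylor_three_le {g : ℝ → ℝ} (hg : ContDiff ℝ 4 g) {M : ℝ}
    (hM : ∀ t, |iteratedDeriv 4 g t| ≤ M) {u : ℝ} (hu : u ≠ 0) :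
    |g u - (g 0 + iteratedDeriv 1 g 0 * u + iteratedDeriv 2 g 0 * u ^ 2 / 2 +
      iteratedDeriv 3 g 0 * u ^ 3 / 6)| ≤ M * u ^ 4 / 24 := by
  obtain ⟨t, -, ht⟩ := taylor_mean_remainder_lagrange_iteratedDeriv (n := 3) hu.symm
    (hg.contDiffOn.of_le (by norm_num))
  have hw : ∀ k : ℕ, k ≤ 4 →
      iteratedDerivWithin k g (Set.uIcc 0 u) 0 = iteratedDeriv k g 0 := fun k hk =>
    iteratedDerivWithin_eq_iteratedDeriv (uniqueDiffOn_uIcc hu.symm)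
      (hg.contDiffAt.of_le (by exact_mod_cast hk)) Set.left_mem_uIcc
  simp only [taylorWithinEval_succ, taylor_within_zero_eval, zero_add] at ht
  rw [hw 1 (by norm_num), hw (1 + 1) (by norm_num), hw (2 + 1) (by norm_num)] at ht
  norm_num [Nat.factorial] at ht
  have e : g u - (g 0 + iteratedDeriv 1 g 0 * u + iteratedDeriv 2 g 0 * u ^ 2 / 2 +
      iteratedDeriv 3 g 0 * u ^ 3 / 6) = iteratedDeriv 4 g t * u ^ 4 / 24 := by
    rw [← ht]; simp only [iteratedDeriv_one]; ring
  have h4 : 0 ≤ u ^ 4 := by positivity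
  rw [e, abs_div, abs_mul, abs_of_nonneg h4, abs_of_pos (by norm_num : (0 : ℝ) < 24)]
  gcongr
  exact hM t

theorem abs_second_difference_sub_iteratedDeriv_two_le {g : ℝ → ℝ} (hg : ContDiff ℝ 4 g) {M : ℝ}
    (hM : ∀ t, |iteratedDeriv 4 g t| ≤ M) {u : ℝ} (hu : u ≠ 0) :
    |(g u + g (-u) - 2 * g 0) / u ^ 2 - iteratedDeriv 2 g 0| ≤ M * u ^ 2 / 12 := by
  have h₁ := abs_le.1 (abs_sub_taylor_three_le hg hM hu)
  have h₂ := abs_le.1 (abs_sub_taylor_three_le hg hM (neg_ne_zero.2 hu))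
  have hu2 : 0 < u ^ 2 := by positivity
  have e : (g u + g (-u) - 2 * g 0) / u ^ 2 - iteratedDeriv 2 g 0 =
      (g u + g (-u) - 2 * g 0 - iteratedDeriv 2 g 0 * u ^ 2) / u ^ 2 := by field_simp
  rw [e, abs_div, abs_of_pos hu2, div_le_iff₀ hu2, abs_le]
  constructor <;> linarith [h₁.1, h₁.2, h₂.1, h₂.2]


/-- If `f : ℝ^N → ℝ` is four times continuously differentiable with all
fourth-order partial derivatives bounded in absolute value by `α₀ > 0` on all of `ℝ^N`, then
for every `x, d ∈ ℝ^N` and `δ > 0`, the second difference satisfies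
`|(f(x+δd) + f(x−δd) − 2f(x))/δ² − dᵀ∇²f(x)d| ≤ (α₀ δ²/12) (∑ i |d i|)⁴`.  Here fourth partial
derivatives are expressed by applying the fourth iterated Fréchet derivative to standard basis
vectors, and the Hessian quadratic form `dᵀ∇²f(x)d` is `iteratedFDeriv ℝ 2 f x ![d, d]`. -/
theorem second_difference_hessian_bias (N : ℕ) (f : (Fin N → ℝ) → ℝ) (α₀ : ℝ)
    (hα : 0 < α₀) (hf : ContDiff ℝ 4 f)
    (hbound : ∀ (x : Fin N → ℝ) (i j k l : Fin N),
      |iteratedFDeriv ℝ 4 f x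
        ![Pi.single i 1, Pi.single j 1, Pi.single k 1, Pi.single l 1]| ≤ α₀)
    (x d : Fin N → ℝ) (δ : ℝ) (hδ : 0 < δ) :
    |(f (x + δ • d) + f (x - δ • d) - 2 * f x) / δ ^ 2 -
        iteratedFDeriv ℝ 2 f x ![d, d]| ≤
      α₀ * δ ^ 2 / 12 * (∑ i, |d i|) ^ 4 := by
  have hg : ContDiff ℝ 4 fun s : ℝ => f (x + s • d) := by fun_prop
  have hM : ∀ t, |iteratedDeriv 4 (fun s : ℝ => f (x + s • d)) t| ≤ α₀ * (∑ i, |d i|) ^ 4 := by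
    intro t
    rw [iteratedDeriv_comp_add_smul hf x d le_rfl]
    refine ContinuousMultilinearMap.abs_apply_diag_le_of_single _ (fun r => ?_) d
    convert! hbound (x + t • d) (r 0) (r 1) (r 2) (r 3) using 3
    ext k : 1
    fin_cases k <;> rfl
  have h := abs_second_difference_sub_iteratedDeriv_two_le hg hM hδ.ne'
  rw [iteratedDeriv_comp_add_smul hf x d (by norm_num)] at h
  have hdd : (fun _ : Fin 2 => d) = ![d, d] := by
    ext k : 1
    fin_cases k <;> rfl
  simp only [zero_smul, add_zero, neg_smul, ← sub_eq_add_neg, hdd] at h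
  linarith
end

section
/- Let N ≥ 1, let σ be a permutation of {1,…,N}, and let e_1,…,e_N be the standard basis of ℝ^N. Let f : ℝ^N → ℝ be three times continuously differentiable with all third-order partial derivatives bounded in absolute value by α₀ > 0. Fix x ∈ ℝ^N and δ > 0. On a probability space, let ξ_m⁺, ξ_m⁻ (m = 1,…,N) be integrable real random variables with E[ξ_m⁺ − ξ_m⁻] = 0 for every m, and define the 1RDSA-Perm-DP gradient estimate ĝ = ∑_{m=1}^{N} e_{σ(m)} · (f(x + δ e_{σ(m)}) + ξ_m⁺ − f(x − δ e_{σ(m)}) − ξ_m⁻)/(2δ). Then for every coordinate i ∈ {1,…,N}, | E[ĝ_i] − ∂_i f(x) | ≤ C₀ δ², where C₀ = α₀ N³ / 6. -/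
open Finset MeasureTheory

theorem abs_sub_quadratic_taylor_le {g : ℝ → ℝ} (hg : ContDiff ℝ 3 g) {M : ℝ}
    (hM : ∀ s, |iteratedDeriv 3 g s| ≤ M) (t : ℝ) :
    |g t - (g 0 + deriv g 0 * t + iteratedDeriv 2 g 0 / 2 * t ^ 2)| ≤ M / 6 * |t| ^ 3 := by
  rcases eq_or_ne t 0 with rfl | ht
  · simp
  obtain ⟨s, -, hs⟩ := taylor_mean_remainder_lagrange_iteratedDeriv (n := 2) (x₀ := 0)
    ht.symm (by exact_mod_cast hg.contDiffOn)
  have hu : UniqueDiffOn ℝ (Set.uIcc 0 t) := uniqueDiffOn_uIcc ht.symm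
  have h1 : iteratedDerivWithin 1 g (Set.uIcc 0 t) 0 = deriv g 0 := by
    rw [iteratedDerivWithin_eq_iteratedDeriv hu
      (hg.contDiffAt.of_le (by norm_cast)) Set.left_mem_uIcc, iteratedDeriv_one]
  have h2 : iteratedDerivWithin 2 g (Set.uIcc 0 t) 0 = iteratedDeriv 2 g 0 :=
    iteratedDerivWithin_eq_iteratedDeriv hu
      (hg.contDiffAt.of_le (by norm_cast)) Set.left_mem_uIcc
  have hexp : g t - (g 0 + deriv g 0 * t + iteratedDeriv 2 g 0 / 2 * t ^ 2) =
      iteratedDeriv 3 g s / 6 * t ^ 3 := by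
    simp only [taylor_within_apply, Finset.sum_range_succ, Finset.sum_range_zero,
      iteratedDerivWithin_zero, h1, h2] at hs
    norm_num [Nat.factorial] at hs
    linarith
  rw [hexp, abs_mul, abs_pow, abs_div, abs_of_pos (by norm_num : (0 : ℝ) < 6)]
  gcongr
  exact hM s

theorem abs_central_difference_sub_deriv_le {g : ℝ → ℝ} (hg : ContDiff ℝ 3 g) {M : ℝ}
    (hM : ∀ s, |iteratedDeriv 3 g s| ≤ M) {δ : ℝ} (hδ : 0 < δ) :
    |(g δ - g (-δ)) / (2 * δ) - deriv g 0| ≤ M / 6 * δ ^ 2 := by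
  have hp := abs_le.1 (abs_sub_quadratic_taylor_le hg hM δ)
  have hn := abs_le.1 (abs_sub_quadratic_taylor_le hg hM (-δ))
  rw [abs_neg, abs_of_pos hδ] at hn
  rw [abs_of_pos hδ] at hp
  have hrw : (g δ - g (-δ)) / (2 * δ) - deriv g 0 =
      (g δ - g (-δ) - 2 * δ * deriv g 0) / (2 * δ) := by
    field_simp
  rw [hrw, abs_div, abs_of_pos (by positivity : 0 < 2 * δ), div_le_iff₀ (by positivity), abs_le]
  constructor <;> nlinarith [hp.1, hp.2, hn.1, hn.2]

section Line

variable {E F : Type*} [NormedAddCommGroup E] [NormedSpace ℝ E]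
  [NormedAddCommGroup F] [NormedSpace ℝ F]

theorem iteratedDeriv_comp_line {n : ℕ} {f : E → F} (hf : ContDiff ℝ n f) (x v : E) (s : ℝ) :
    iteratedDeriv n (fun t : ℝ => f (x + t • v)) s =
      iteratedFDeriv ℝ n f (x + s • v) fun _ => v := by
  have h := (ContinuousLinearMap.toSpanSingleton ℝ v).iteratedFDeriv_comp_right
    (f := fun y => f (x + y)) (hf.comp (contDiff_const.add contDiff_id)) s le_rfl
  rw [iteratedFDeriv_comp_add_left] at h
  have h' := congrArg (fun φ => φ fun _ => (1 : ℝ)) h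
  simpa [iteratedDeriv_eq_iteratedFDeriv, Function.comp_def] using h'

theorem abs_central_difference_sub_fderiv_le {f : E → ℝ} (hf : ContDiff ℝ 3 f) {M : ℝ} (x v : E)
    (hM : ∀ y, |iteratedFDeriv ℝ 3 f y fun _ => v| ≤ M) {δ : ℝ} (hδ : 0 < δ) :
    |(f (x + δ • v) - f (x - δ • v)) / (2 * δ) - fderiv ℝ f x v| ≤ M / 6 * δ ^ 2 := by
  have hline : ContDiff ℝ 3 fun t : ℝ => f (x + t • v) := by fun_prop
  have hderiv : deriv (fun t : ℝ => f (x + t • v)) 0 = fderiv ℝ f x v :=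
    (hf.differentiable (by norm_num) x).lineDeriv_eq_fderiv
  have h := abs_central_difference_sub_deriv_le hline
    (fun s => by
      rw [iteratedDeriv_comp_line (by exact_mod_cast hf)]
      exact hM _) hδ
  rw [hderiv] at h
  simpa only [neg_smul, ← sub_eq_add_neg] using h

end Line

/-- Asymptotic unbiasedness of the 1RDSA-Perm-DP gradient estimate: with
perturbation directions the standard basis vectors `e_{σ(m)}` (the rows of a permutation
matrix), zero-mean integrable measurement noises `ξ_m⁺, ξ_m⁻`, and `f` three times
continuously differentiable with third-order partials bounded by `α₀`, the gradient estimate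
`ĝ = ∑_m e_{σ(m)} (f(x+δe_{σ(m)})+ξ_m⁺ − f(x−δe_{σ(m)}) − ξ_m⁻)/(2δ)` satisfies,
coordinatewise, `|E[ĝ_i] − ∂_i f(x)| ≤ C₀ δ²` with `C₀ = α₀ N³ / 6`. -/
theorem oneRDSA_perm_dp_gradient_estimate_bias (N : ℕ) (hN : 1 ≤ N)
    (σ : Equiv.Perm (Fin N))
    (f : (Fin N → ℝ) → ℝ) (α₀ : ℝ) (hα : 0 < α₀) (hf : ContDiff ℝ 3 f)
    (hbound : ∀ (x : Fin N → ℝ) (i j k : Fin N),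
      |iteratedFDeriv ℝ 3 f x ![Pi.single i 1, Pi.single j 1, Pi.single k 1]| ≤ α₀)
    (x : Fin N → ℝ) (δ : ℝ) (hδ : 0 < δ)
    {Ω : Type*} [MeasureSpace Ω] [IsProbabilityMeasure (volume : Measure Ω)]
    (ξp ξm : Fin N → Ω → ℝ)
    (hintp : ∀ m, Integrable (ξp m)) (hintm : ∀ m, Integrable (ξm m))
    (hmean : ∀ m, (∫ ω, (ξp m ω - ξm m ω)) = 0)
    (ghat : Ω → (Fin N → ℝ))
    (hg : ∀ ω, ghat ω =
      ∑ m : Fin N,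
        (((f (x + δ • (Pi.single (σ m) 1 : Fin N → ℝ)) + ξp m ω -
            f (x - δ • (Pi.single (σ m) 1 : Fin N → ℝ)) - ξm m ω) / (2 * δ)) •
          (Pi.single (σ m) 1 : Fin N → ℝ)))
    (i : Fin N) :
    |(∫ ω, ghat ω i) - fderiv ℝ f x (Pi.single i 1)| ≤ (α₀ * N ^ 3 / 6) * δ ^ 2 := by
  obtain ⟨m, rfl⟩ := σ.surjective i
  set v : Fin N → ℝ := Pi.single (σ m) 1
  have hcoord : ∀ ω, ghat ω (σ m) =
      (f (x + δ • v) - f (x - δ • v)) / (2 * δ) + (ξp m ω - ξm m ω) / (2 * δ) := by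
    intro ω
    rw [hg, Finset.sum_apply, Finset.sum_eq_single m]
    · simp only [Pi.smul_apply, Pi.single_eq_same, smul_eq_mul, mul_one, v]
      ring
    · intro k _ hk
      simp [Pi.single_eq_of_ne (σ.injective.ne hk.symm)]
    · simp
  have hmeanhat : ∫ ω, ghat ω (σ m) = (f (x + δ • v) - f (x - δ • v)) / (2 * δ) := by
    have hnoise : Integrable fun ω => (ξp m ω - ξm m ω) / (2 * δ) :=
      ((hintp m).sub (hintm m)).div_const _
    simp_rw [hcoord]
    rw [integral_add (integrable_const _) hnoise, integral_const, integral_div, hmean m]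
    simp
  have hthird : ∀ y, |iteratedFDeriv ℝ 3 f y fun _ => v| ≤ α₀ := by
    intro y
    convert hbound y (σ m) (σ m) (σ m) using 3
    ext k
    fin_cases k <;> rfl
  rw [hmeanhat]
  refine (abs_central_difference_sub_fderiv_le hf x v hthird hδ).trans ?_
  gcongr
  exact le_mul_of_one_le_right hα.le (one_le_pow₀ (by exact_mod_cast hN))
end

section
/- Let H* and H̄_0 be real N×N matrices, let 0 < b₀ ≤ 1 and 0 < r < 1, set b_n = b₀ / n^r for n ≥ 1, and define recursively H̄_n = (1 − b_n) H̄_{n−1} + b_n H*. Let Λ_n = H̄_n − H*. Then for every n ≥ 1, trace(Λ_nᵀ Λ_n) ≤ exp(2b₀/(1−r)) · exp(−2 b₀ n^{1−r} / (1 − r)) · trace(Λ_0ᵀ Λ_0); in particular trace(Λ_nᵀ Λ_n) = O(exp(−2 b₀ n^{1−r} / (1 − r))). -/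
open Matrix

theorem rpow_add_one_le_rpow_add {x p : ℝ} (hx : 0 < x) (hp : 0 ≤ p) (hp' : p ≤ 1) :
    (x + 1) ^ p ≤ x ^ p + p * x ^ (p - 1) := by
  have h : (1 + 1 / x) ^ p ≤ 1 + p * (1 / x) :=
    rpow_one_add_le_one_add_mul_self (by have := one_div_pos.mpr hx; linarith) hp hp'
  have hfac : x + 1 = x * (1 + 1 / x) := by field_simp
  calc (x + 1) ^ p = x ^ p * (1 + 1 / x) ^ p := by
        rw [hfac, Real.mul_rpow hx.le (by positivity)]
    _ ≤ x ^ p * (1 + p * (1 / x)) := by gcongr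
    _ = x ^ p + p * x ^ (p - 1) := by rw [Real.rpow_sub_one hx.ne']; ring

theorem one_sub_sq_le_exp {b : ℝ} (hb : b ≤ 1) : (1 - b) ^ 2 ≤ Real.exp (-(2 * b)) := by
  calc (1 - b) ^ 2 ≤ Real.exp (-b) ^ 2 :=
        pow_le_pow_left₀ (by linarith) (Real.one_sub_le_exp_neg b) 2
    _ = Real.exp (-(2 * b)) := by rw [← Real.exp_nat_mul]; congr 1; push_cast; ring

theorem trace_transpose_mul_self_nonneg {m n : Type*} [Fintype m] [Fintype n]
    (A : Matrix m n ℝ) : 0 ≤ (Aᵀ * A).trace := by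
  simp only [Matrix.trace, Matrix.diag_apply, Matrix.mul_apply, Matrix.transpose_apply]
  exact Finset.sum_nonneg fun _ _ => Finset.sum_nonneg fun _ _ => mul_self_nonneg _

/-- Contracting by the factors `(1 - b₀ / k ^ r) ^ 2` yields decay at the rate of the integral
of `x ^ (-r)` over `[1, n + 1]`. -/
theorem le_exp_of_sq_contraction {b₀ r : ℝ} (hb₀ : 0 < b₀) (hb₀' : b₀ ≤ 1) (hr : 0 < r)
    (hr' : r < 1) {T : ℕ → ℝ} (hT : ∀ n, 0 ≤ T n)
    (hstep : ∀ n : ℕ, T (n + 1) = (1 - b₀ / ((n : ℝ) + 1) ^ r) ^ 2 * T n) (n : ℕ) :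
    T n ≤ Real.exp (2 * b₀ / (1 - r) * (1 - ((n : ℝ) + 1) ^ (1 - r))) * T 0 := by
  have hr1 : 0 < 1 - r := sub_pos.mpr hr'
  induction n with
  | zero => simp
  | succ n ih =>
    set x : ℝ := (n : ℝ) + 1 with hx
    have hx1 : 1 ≤ x := by rw [hx]; linarith [Nat.cast_nonneg (α := ℝ) n]
    have hx0 : 0 < x := by linarith
    have hb : b₀ / x ^ r ≤ 1 :=
      div_le_one_of_le₀ (hb₀'.trans (Real.one_le_rpow hx1 hr.le)) (by positivity)
    have hconc := rpow_add_one_le_rpow_add hx0 hr1.le (by linarith)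
    have hexp : -(2 * (b₀ / x ^ r)) + 2 * b₀ / (1 - r) * (1 - x ^ (1 - r)) ≤
        2 * b₀ / (1 - r) * (1 - (x + 1) ^ (1 - r)) := by
      have hpow : x ^ (1 - r - 1) = 1 / x ^ r := by
        rw [show 1 - r - 1 = -r by ring, Real.rpow_neg hx0.le, one_div]
      calc -(2 * (b₀ / x ^ r)) + 2 * b₀ / (1 - r) * (1 - x ^ (1 - r))
          = 2 * b₀ / (1 - r) * (1 - (x ^ (1 - r) + (1 - r) * x ^ (1 - r - 1))) := by
            rw [hpow]; field_simp; ring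
        _ ≤ _ := by gcongr
    calc T (n + 1) = (1 - b₀ / x ^ r) ^ 2 * T n := hstep n
      _ ≤ Real.exp (-(2 * (b₀ / x ^ r))) *
            (Real.exp (2 * b₀ / (1 - r) * (1 - x ^ (1 - r))) * T 0) :=
          mul_le_mul (one_sub_sq_le_exp hb) ih (hT n) (Real.exp_nonneg _)
      _ = Real.exp (-(2 * (b₀ / x ^ r)) + 2 * b₀ / (1 - r) * (1 - x ^ (1 - r))) * T 0 := by
          rw [Real.exp_add]; ring
      _ ≤ Real.exp (2 * b₀ / (1 - r) * (1 - (x + 1) ^ (1 - r))) * T 0 :=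
          mul_le_mul_of_nonneg_right (Real.exp_le_exp.mpr hexp) (hT 0)
      _ = _ := by push_cast; rfl

/-- Convergence rate of the noise-free Hessian averaging recursion: with
`b_n = b₀/n^r` for `0 < b₀ ≤ 1` and `0 < r < 1`, and `H̄_n = (1 − b_n) H̄_{n−1} + b_n H*`,
the error `Λ_n = H̄_n − H*` satisfies, for every `n ≥ 1`,
`trace(Λ_nᵀ Λ_n) ≤ exp(2b₀/(1−r)) exp(−2b₀ n^{1−r}/(1−r)) trace(Λ_0ᵀ Λ_0)`;
in particular `trace(Λ_nᵀ Λ_n) = O(exp(−2b₀ n^{1−r}/(1−r)))`. -/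
theorem hessian_recursion_rate (N : ℕ) (Hstar : Matrix (Fin N) (Fin N) ℝ)
    (b₀ r : ℝ) (hb₀ : 0 < b₀) (hb₀' : b₀ ≤ 1) (hr : 0 < r) (hr' : r < 1)
    (b : ℕ → ℝ) (hb : ∀ n : ℕ, 1 ≤ n → b n = b₀ / (n : ℝ) ^ r)
    (Hbar : ℕ → Matrix (Fin N) (Fin N) ℝ)
    (hrec : ∀ n : ℕ, 1 ≤ n → Hbar n = (1 - b n) • Hbar (n - 1) + b n • Hstar)
    (n : ℕ) (hn : 1 ≤ n) :
    ((Hbar n - Hstar)ᵀ * (Hbar n - Hstar)).trace ≤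
      Real.exp (2 * b₀ / (1 - r)) * Real.exp (-(2 * b₀ * (n : ℝ) ^ (1 - r) / (1 - r))) *
        ((Hbar 0 - Hstar)ᵀ * (Hbar 0 - Hstar)).trace := by
  have hr1 : 0 < 1 - r := sub_pos.mpr hr'
  have hstep : ∀ k : ℕ, ((Hbar (k + 1) - Hstar)ᵀ * (Hbar (k + 1) - Hstar)).trace =
      (1 - b₀ / ((k : ℝ) + 1) ^ r) ^ 2 * ((Hbar k - Hstar)ᵀ * (Hbar k - Hstar)).trace := by
    intro k
    have hdiff : Hbar (k + 1) - Hstar = (1 - b (k + 1)) • (Hbar k - Hstar) := by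
      rw [hrec (k + 1) (by omega), Nat.add_sub_cancel]
      module
    have hbk : b (k + 1) = b₀ / ((k : ℝ) + 1) ^ r := by
      rw [hb (k + 1) (by omega)]; push_cast; rfl
    rw [hdiff, Matrix.transpose_smul, Matrix.smul_mul, Matrix.mul_smul, Matrix.trace_smul,
      Matrix.trace_smul, hbk, smul_eq_mul, smul_eq_mul]
    ring
  refine (le_exp_of_sq_contraction hb₀ hb₀' hr hr'
    (T := fun k => ((Hbar k - Hstar)ᵀ * (Hbar k - Hstar)).trace)
    (fun k => trace_transpose_mul_self_nonneg _) hstep n).trans ?_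
  refine mul_le_mul_of_nonneg_right ?_ (trace_transpose_mul_self_nonneg _)
  rw [← Real.exp_add, Real.exp_le_exp]
  calc 2 * b₀ / (1 - r) * (1 - ((n : ℝ) + 1) ^ (1 - r))
      ≤ 2 * b₀ / (1 - r) * (1 - (n : ℝ) ^ (1 - r)) := by gcongr; linarith
    _ = _ := by ring
end
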